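/- For every real x with 0 < x < 1, the ordinary generating function of the language G satisfies φ_G(x) = Σ_{w∈G} π(w) x^{|w|} = Σ_{ℓ=0}^{m} C(m,ℓ) (1−p)^ℓ / C(m/x − 1, ℓ), where C(z,ℓ) = z(z−1)⋯(z−ℓ+1)/ℓ! denotes the generalized binomial coefficient. -/

import Mathlib

noncomputable section

/-- The probability weight of a word over the alphabet `{c_1, …, c_m, d_1, …, d_m}`,
encoded as `Fin m ⊕ Fin m` where `Sum.inl i` is the letter `c_i` (a successful collection
of coupon `i`, of probability `(1-p)/m`) and `Sum.inr i` is the letter `d_i` (a clumsy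
loss of coupon `i`, of probability `p/m`); the weight of a word is the product of the
weights of its letters. -/
def wordWeight (m : ℕ) (p : ℝ) (w : List (Fin m ⊕ Fin m)) : ℝ :=
  (w.map (Sum.elim (fun _ => (1 - p) / (m : ℝ)) (fun _ => p / (m : ℝ)))).prod

/-- The language `H`: words in which, for every `i`, the letter `c_i` occurs and its final
occurrence is not followed by any `d_i`. -/
def langH (m : ℕ) : Set (List (Fin m ⊕ Fin m)) :=
  {w | ∀ i : Fin m, ∃ u v : List (Fin m ⊕ Fin m),
    w = u ++ Sum.inl i :: v ∧ Sum.inl i ∉ v ∧ Sum.inr i ∉ v}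

/-- The language `G`: words in which, for every `i`, if `d_i` occurs then its final
occurrence is followed by some `c_i`. -/
def langG (m : ℕ) : Set (List (Fin m ⊕ Fin m)) :=
  {w | ∀ i : Fin m, Sum.inr i ∈ w →
    ∃ u v : List (Fin m ⊕ Fin m),
      w = u ++ Sum.inr i :: v ∧ Sum.inr i ∉ v ∧ Sum.inl i ∈ v}

/-- The language `J`: words of `H` none of whose proper prefixes lie in `H`. -/
def langJ (m : ℕ) : Set (List (Fin m ⊕ Fin m)) :=
  {w | w ∈ langH m ∧
    ∀ u v : List (Fin m ⊕ Fin m), w = u ++ v → v ≠ [] → u ∉ langH m}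

/-- Generalised binomial coefficient `C(z, k) = z (z-1) ⋯ (z-k+1) / k!`. -/
def genBinom (z : ℝ) (k : ℕ) : ℝ :=
  (∏ j ∈ Finset.range k, (z - (j : ℝ))) / (Nat.factorial k : ℝ)

open Finset

/-- Weight of a letter, with the variable `x` included. -/
def letterW (m : ℕ) (p x : ℝ) : Fin m ⊕ Fin m → ℝ :=
  Sum.elim (fun _ => (1 - p) / (m : ℝ) * x) (fun _ => p / (m : ℝ) * x)

theorem wordWeight_mul (m : ℕ) (p x : ℝ) (w : List (Fin m ⊕ Fin m)) :
    wordWeight m p w * x ^ w.length = (w.map (letterW m p x)).prod := by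
  unfold wordWeight
  induction w with
  | nil => simp
  | cons a w ih =>
    simp only [List.map_cons, List.prod_cons, List.length_cons, ← ih, pow_succ]
    rcases a with i | i <;> simp [letterW] <;> ring

theorem summable_words {A : Type*} [Fintype A] (a : A → ℝ) (ha : ∀ i, 0 ≤ a i)
    (h1 : ∑ i, a i < 1) : Summable (fun w : List A => (w.map a).prod) := by
  rw [← (List.equivSigmaTuple (α := A)).symm.summable_iff]
  have key : ∀ (n : ℕ) (f : Fin n → A),
      ((fun w : List A => (w.map a).prod) ∘ (List.equivSigmaTuple (α := A)).symm) ⟨n, f⟩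
        = ∏ i, a (f i) := by
    intro n f
    simp [List.equivSigmaTuple, List.map_ofFn, List.prod_ofFn]
  rw [summable_sigma_of_nonneg]
  · refine ⟨fun n => (hasSum_fintype _).summable, ?_⟩
    have : (fun n : ℕ => ∑' f : Fin n → A,
        ((fun w : List A => (w.map a).prod) ∘ (List.equivSigmaTuple (α := A)).symm) ⟨n, f⟩)
        = fun n => (∑ i, a i) ^ n := by
      funext n
      rw [tsum_fintype, Fintype.sum_pow]
      exact Finset.sum_congr rfl fun f _ => key n f
    rw [this]
    exact summable_geometric_of_lt_one (Finset.sum_nonneg fun i _ => ha i) h1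
  · rintro ⟨n, f⟩
    rw [key]
    exact Finset.prod_nonneg fun i _ => ha _

/-- Relaxed version of `G`, ignoring the coupons in `S`. -/
def relG (m : ℕ) (S : Finset (Fin m)) (w : List (Fin m ⊕ Fin m)) : Prop :=
  ∀ i : Fin m, i ∉ S → Sum.inr i ∈ w →
    ∃ u v : List (Fin m ⊕ Fin m),
      w = u ++ Sum.inr i :: v ∧ Sum.inr i ∉ v ∧ Sum.inl i ∈ v

theorem exists_last {A : Type*} (a : A) (w : List A) (h : a ∈ w) :
    ∃ u v, w = u ++ a :: v ∧ a ∉ v := by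
  induction w with
  | nil => simp at h
  | cons b w ih =>
    by_cases hw : a ∈ w
    · obtain ⟨u, v, e, hv⟩ := ih hw
      exact ⟨b :: u, v, by simp [e], hv⟩
    · have : a = b := by simpa [hw] using h
      exact ⟨[], w, by simp [this], hw⟩

theorem snoc_split {A : Type*} {w u v : List A} {a b : A} (h : w ++ [b] = u ++ a :: v) :
    (v = [] ∧ a = b ∧ u = w) ∨ ∃ v', v = v' ++ [b] ∧ w = u ++ a :: v' := by
  rcases List.eq_nil_or_concat v with rfl | ⟨v', c, rfl⟩
  · left
    have := List.append_inj' h rfl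
    simp at this
    exact ⟨rfl, this.2.symm, this.1.symm⟩
  · right
    have h2 : w ++ [b] = (u ++ a :: v') ++ [c] := by simpa using h
    have := List.append_inj' h2 rfl
    simp at this
    exact ⟨v', by simp [this.2], this.1⟩

theorem relG_inl (m : ℕ) (S : Finset (Fin m)) (w : List (Fin m ⊕ Fin m)) (j : Fin m) :
    relG m S (w ++ [Sum.inl j]) ↔ relG m (insert j S) w := by
  constructor
  · intro h i hi hw
    simp only [Finset.mem_insert, not_or] at hi
    obtain ⟨u, v, e, h1, h2⟩ := h i hi.2 (by simp [hw])
    rcases snoc_split e with ⟨_, h3, _⟩ | ⟨v', rfl, rfl⟩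
    · simp at h3
    · refine ⟨u, v', rfl, ?_, ?_⟩
      · simpa using h1
      · simpa [hi.1] using h2
  · intro h i hi hw
    have hw' : Sum.inr i ∈ w := by simpa using hw
    by_cases hij : i = j
    · subst hij
      obtain ⟨u, v, rfl, hv⟩ := exists_last _ _ hw'
      exact ⟨u, v ++ [Sum.inl i], by simp, by simpa using hv, by simp⟩
    · obtain ⟨u, v, rfl, h1, h2⟩ := h i (by simp [hij, hi]) hw'
      exact ⟨u, v ++ [Sum.inl j], by simp, by simpa using h1, by simp [h2]⟩

theorem relG_inr (m : ℕ) (S : Finset (Fin m)) (w : List (Fin m ⊕ Fin m)) (j : Fin m) :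
    relG m S (w ++ [Sum.inr j]) ↔ j ∈ S ∧ relG m S w := by
  constructor
  · intro h
    have hj : j ∈ S := by
      by_contra hj
      obtain ⟨u, v, e, h1, h2⟩ := h j hj (by simp)
      rcases snoc_split e with ⟨rfl, _, _⟩ | ⟨v', rfl, rfl⟩
      · simp at h2
      · simp at h1
    refine ⟨hj, fun i hi hw => ?_⟩
    have hij : i ≠ j := fun e => hi (e ▸ hj)
    obtain ⟨u, v, e, h1, h2⟩ := h i hi (by simp [hw])
    rcases snoc_split e with ⟨_, h3, _⟩ | ⟨v', rfl, rfl⟩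
    · simp [hij] at h3
    · refine ⟨u, v', rfl, ?_, ?_⟩
      · simp at h1; exact h1.1
      · simpa using h2
  · rintro ⟨hj, h⟩ i hi hw
    have hij : i ≠ j := fun e => hi (e ▸ hj)
    obtain ⟨u, v, rfl, h1, h2⟩ := h i hi (by simpa [hij] using hw)
    exact ⟨u, v ++ [Sum.inr j], by simp, by simp [h1, hij], by simp [h2]⟩

/-- Nil/cons decomposition of lists. -/
def listEquiv (A : Type*) : Unit ⊕ (A × List A) ≃ List A where
  toFun o := Sum.elim (fun _ => []) (fun q => q.1 :: q.2) o
  invFun l := match l with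
    | [] => Sum.inl ()
    | a :: l => Sum.inr (a, l)
  left_inv o := by rcases o with _ | ⟨a, l⟩ <;> rfl
  right_inv l := by rcases l with _ | ⟨a, l⟩ <;> rfl

theorem tsum_list {A : Type*} [Fintype A] (f : List A → ℝ) (hf : Summable f) :
    ∑' w, f w = f [] + ∑ a, ∑' w, f (a :: w) := by
  have hf' : Summable (f ∘ listEquiv A) := (listEquiv A).summable_iff.mpr hf
  have hs : Summable (fun q : A × List A => f (q.1 :: q.2)) :=
    hf'.comp_injective Sum.inr_injective
  have h1 : HasSum ((f ∘ listEquiv A) ∘ Sum.inl) (f []) := by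
    have := hasSum_fintype ((f ∘ listEquiv A) ∘ Sum.inl)
    simpa [listEquiv] using this
  have h2 : HasSum ((f ∘ listEquiv A) ∘ Sum.inr) (∑' q : A × List A, f (q.1 :: q.2)) := hs.hasSum
  have h3 := (listEquiv A).hasSum_iff.mp (HasSum.sum h1 h2)
  rw [h3.tsum_eq, hs.tsum_prod, tsum_fintype]

open Classical in
/-- Summand of the generating function of the relaxed language (reversed words). -/
def summ (m : ℕ) (p x : ℝ) (S : Finset (Fin m)) (w : List (Fin m ⊕ Fin m)) : ℝ :=
  if relG m S w.reverse then (w.map (letterW m p x)).prod else 0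

theorem summ_pos (m : ℕ) (p x : ℝ) (S : Finset (Fin m)) (w : List (Fin m ⊕ Fin m))
    (h : relG m S w.reverse) : summ m p x S w = (w.map (letterW m p x)).prod := if_pos h

theorem summ_neg (m : ℕ) (p x : ℝ) (S : Finset (Fin m)) (w : List (Fin m ⊕ Fin m))
    (h : ¬ relG m S w.reverse) : summ m p x S w = 0 := if_neg h

theorem summ_inl (m : ℕ) (p x : ℝ) (S : Finset (Fin m)) (w : List (Fin m ⊕ Fin m)) (j : Fin m) :
    summ m p x S (Sum.inl j :: w) = (1 - p) / m * x * summ m p x (insert j S) w := by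
  have e := relG_inl m S w.reverse j
  rw [← List.reverse_cons] at e
  by_cases h : relG m (insert j S) w.reverse
  · rw [summ_pos _ _ _ _ _ h, summ_pos _ _ _ _ _ (e.mpr h)]
    simp [letterW]
  · rw [summ_neg _ _ _ _ _ h, summ_neg _ _ _ _ _ (fun h' => h (e.mp h')), mul_zero]

theorem summ_inr (m : ℕ) (p x : ℝ) (S : Finset (Fin m)) (w : List (Fin m ⊕ Fin m)) (j : Fin m) :
    summ m p x S (Sum.inr j :: w) = if j ∈ S then p / m * x * summ m p x S w else 0 := by
  have e := relG_inr m S w.reverse j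
  rw [← List.reverse_cons] at e
  by_cases hj : j ∈ S
  · rw [if_pos hj]
    by_cases h : relG m S w.reverse
    · rw [summ_pos _ _ _ _ _ h, summ_pos _ _ _ _ _ (e.mpr ⟨hj, h⟩)]
      simp [letterW]
    · rw [summ_neg _ _ _ _ _ h, summ_neg _ _ _ _ _ (fun h' => h (e.mp h').2), mul_zero]
  · rw [if_neg hj, summ_neg _ _ _ _ _ (fun h' => hj (e.mp h').1)]

theorem summable_summ (m : ℕ) (hm : 1 ≤ m) (p : ℝ) (hp : p ∈ Set.Ico (0:ℝ) 1)
    (x : ℝ) (hx0 : 0 < x) (hx1 : x < 1) (S : Finset (Fin m)) :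
    Summable (summ m p x S) := by
  have hm' : (0:ℝ) < m := by exact_mod_cast hm
  have hp1 : 0 ≤ 1 - p := by linarith [hp.2]
  have hp0 := hp.1
  have ha : ∀ i, 0 ≤ letterW m p x i := by
    rintro (i | i) <;> simp only [letterW, Sum.elim_inl, Sum.elim_inr] <;> positivity
  have h1 : ∑ i, letterW m p x i < 1 := by
    simp only [Fintype.sum_sum_type, letterW, Sum.elim_inl, Sum.elim_inr, Finset.sum_const,
      Finset.card_univ, Fintype.card_fin, nsmul_eq_mul]
    have : (m:ℝ) * ((1 - p) / m * x) + m * (p / m * x) = x := by field_simp; ring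
    rw [this]; exact hx1
  have hpos : ∀ w : List (Fin m ⊕ Fin m), 0 ≤ (w.map (letterW m p x)).prod := by
    intro w
    apply List.prod_nonneg
    intro a h
    obtain ⟨b, _, rfl⟩ := List.mem_map.mp h
    exact ha b
  refine Summable.of_nonneg_of_le (fun w => ?_) (fun w => ?_) (summable_words _ ha h1)
  · unfold summ; split_ifs
    · exact hpos w
    · exact le_rfl
  · unfold summ; split_ifs
    · exact le_rfl
    · exact hpos w

theorem rec_summ (m : ℕ) (hm : 1 ≤ m) (p : ℝ) (hp : p ∈ Set.Ico (0:ℝ) 1)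
    (x : ℝ) (hx0 : 0 < x) (hx1 : x < 1) (S : Finset (Fin m)) :
    ∑' w, summ m p x S w = 1 + ((S.card : ℝ) * x / m * ∑' w, summ m p x S w
      + ∑ j ∈ Sᶜ, (1 - p) / m * x * ∑' w, summ m p x (insert j S) w) := by
  conv_lhs => rw [tsum_list _ (summable_summ m hm p hp x hx0 hx1 S)]
  have h0 : summ m p x S [] = 1 := by simp [summ, relG]
  rw [h0, Fintype.sum_sum_type]
  congr 1
  simp only [summ_inl, summ_inr, tsum_mul_left]
  have e2 : ∀ j : Fin m, (∑' w, if j ∈ S then p / m * x * summ m p x S w else 0)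
      = if j ∈ S then p / m * x * ∑' w, summ m p x S w else 0 := by
    intro j; split_ifs
    · rw [tsum_mul_left]
    · simp
  simp only [e2]
  rw [← Finset.sum_add_sum_compl S, Finset.sum_ite_mem, Finset.univ_inter, Finset.sum_const,
    nsmul_eq_mul]
  have e3 : ∑ j ∈ S, (1 - p) / m * x * ∑' w, summ m p x (insert j S) w
      = S.card * ((1 - p) / m * x * ∑' w, summ m p x S w) := by
    rw [← nsmul_eq_mul, ← Finset.sum_const]
    exact Finset.sum_congr rfl fun j hj => by rw [Finset.insert_eq_of_mem hj]
  rw [e3]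
  ring

/-- Closed form with `k` coupons seen and `n` remaining. -/
def closedE (m : ℕ) (p x : ℝ) (k n : ℕ) : ℝ :=
  ∑ l ∈ range (n + 1), (∏ j ∈ range l, (((m:ℝ) - (k + j : ℕ)) * ((1 - p) / m * x))) /
    ∏ j ∈ range (l + 1), (1 - ((k + j : ℕ) : ℝ) * x / m)

theorem closedE_succ (m : ℕ) (p x : ℝ) (k n : ℕ) (h : 1 - (k : ℝ) * x / m ≠ 0) :
    (1 - (k : ℝ) * x / m) * closedE m p x k (n + 1)
      = 1 + ((m:ℝ) - k) * ((1 - p) / m * x) * closedE m p x (k + 1) n := by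
  unfold closedE
  rw [Finset.sum_range_succ', mul_add, add_comm]
  congr 1
  · simp [mul_inv_cancel₀ h]
  · rw [Finset.mul_sum, Finset.mul_sum]
    refine Finset.sum_congr rfl fun l _ => ?_
    rw [Finset.prod_range_succ', Finset.prod_range_succ' _ (l + 1)]
    have e : ∀ j, k + (j + 1) = k + 1 + j := fun j => by ring
    rw [Finset.prod_congr rfl (fun j _ => by rw [e j]), Finset.prod_congr (s₁ := range (l+1)) rfl (fun j _ => by rw [e j])]
    rw [add_zero]
    rw [mul_comm (∏ j ∈ range (l+1), _) _, mul_div_assoc', mul_div_mul_left _ _ h]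
    ring

theorem tsum_summ (m : ℕ) (hm : 1 ≤ m) (p : ℝ) (hp : p ∈ Set.Ico (0:ℝ) 1)
    (x : ℝ) (hx0 : 0 < x) (hx1 : x < 1) (n : ℕ) : ∀ S : Finset (Fin m), S.card + n = m →
    ∑' w, summ m p x S w = closedE m p x S.card n := by
  have hm' : (0:ℝ) < m := by exact_mod_cast hm
  have hc : ∀ k : ℕ, k ≤ m → 1 - (k : ℝ) * x / m ≠ 0 := by
    intro k hk
    have : (k : ℝ) ≤ m := by exact_mod_cast hk
    have : (k : ℝ) * x / m < 1 := by
      rw [div_lt_one hm']; nlinarith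
    linarith
  induction n with
  | zero =>
    intro S hS
    have hr := rec_summ m hm p hp x hx0 hx1 S
    have hS' : S = univ := by
      rw [← Finset.card_eq_iff_eq_univ]; simpa using hS
    have h2 : Sᶜ = ∅ := by simp [hS']
    rw [h2, Finset.sum_empty] at hr
    have h := hc S.card (by omega)
    simp only [closedE, zero_add, Finset.sum_range_one, Finset.prod_range_one,
      Finset.prod_range_zero, add_zero]
    rw [eq_div_iff h]
    linarith
  | succ n ih =>
    intro S hS
    have hr := rec_summ m hm p hp x hx0 hx1 S
    have h := hc S.card (by omega)
    have e : ∑ j ∈ Sᶜ, (1 - p) / m * x * ∑' w, summ m p x (insert j S) w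
        = ((m:ℝ) - S.card) * ((1 - p) / m * x) * closedE m p x (S.card + 1) n := by
      have : ∀ j ∈ Sᶜ, (1 - p) / m * x * ∑' w, summ m p x (insert j S) w
          = (1 - p) / m * x * closedE m p x (S.card + 1) n := by
        intro j hj
        have hcard : (insert j S).card = S.card + 1 :=
          Finset.card_insert_of_notMem (Finset.mem_compl.mp hj)
        rw [ih (insert j S) (by omega), hcard]
      rw [Finset.sum_congr rfl this, Finset.sum_const, nsmul_eq_mul, Finset.card_compl,
        Fintype.card_fin, Nat.cast_sub (by omega)]
      ring
    rw [e] at hr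
    have h3 := closedE_succ m p x S.card n h
    apply mul_left_cancel₀ h
    rw [h3]
    linarith

theorem term_eq (m : ℕ) (hm : 1 ≤ m) (p x : ℝ) (hx0 : 0 < x) (l : ℕ) (hl : l ≤ m) :
    (∏ j ∈ range l, (((m:ℝ) - (0 + j : ℕ)) * ((1 - p) / m * x))) /
      ∏ j ∈ range (l + 1), (1 - ((0 + j : ℕ) : ℝ) * x / m)
    = (Nat.choose m l : ℝ) * (1 - p) ^ l / genBinom ((m : ℝ) / x - 1) l := by
  have hm' : (0:ℝ) < m := by exact_mod_cast hm
  have h1 : (∏ j ∈ range l, ((m:ℝ) - (j : ℕ))) = (Nat.choose m l : ℝ) * (Nat.factorial l : ℝ) := by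
    have : m.descFactorial l = m.choose l * l.factorial := by
      rw [Nat.descFactorial_eq_factorial_mul_choose, mul_comm]
    rw [← Nat.cast_mul, ← this, Nat.descFactorial_eq_prod_range, Nat.cast_prod]
    refine Finset.prod_congr rfl fun j hj => ?_
    rw [Nat.cast_sub (by have := Finset.mem_range.mp hj; omega)]
  have h2 : ∏ j ∈ range l, ((m:ℝ) / x - 1 - (j : ℝ))
      = (m / x) ^ l * ∏ j ∈ range l, (1 - ((j + 1 : ℕ) : ℝ) * x / m) := by
    rw [← Finset.card_range l, ← Finset.prod_const, Finset.card_range, ← Finset.prod_mul_distrib]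
    refine Finset.prod_congr rfl fun j _ => ?_
    push_cast
    field_simp
    ring
  unfold genBinom
  rw [h2, Finset.prod_range_succ', Finset.prod_mul_distrib, Finset.prod_const, Finset.card_range]
  simp only [zero_add, h1]
  have e : (1 - p) / m * x = (1 - p) * (m / x)⁻¹ := by field_simp
  rw [e, mul_pow, inv_pow]
  simp only [Nat.cast_zero, zero_mul, zero_div, sub_zero, mul_one, div_eq_mul_inv, mul_inv, inv_inv]
  ring

/-- ordinary generating function of `G`:
for `0 < x < 1`, `∑_{w ∈ G} π(w) x^{|w|} = ∑_{ℓ=0}^m C(m,ℓ) (1-p)^ℓ / C(m/x - 1, ℓ)`. -/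
theorem stmt9 (m : ℕ) (hm : 1 ≤ m) (p : ℝ) (hp : p ∈ Set.Ico (0:ℝ) 1)
    (x : ℝ) (hx0 : 0 < x) (hx1 : x < 1) :
    ∑' w : langG m,
        wordWeight m p (w : List (Fin m ⊕ Fin m))
          * x ^ (w : List (Fin m ⊕ Fin m)).length
      = ∑ ℓ ∈ Finset.range (m + 1),
          (Nat.choose m ℓ : ℝ) * (1 - p) ^ ℓ / genBinom ((m : ℝ) / x - 1) ℓ := by
  have h := tsum_summ m hm p hp x hx0 hx1 m ∅ (by simp)
  have hc : closedE m p x (∅ : Finset (Fin m)).card m = ∑ ℓ ∈ Finset.range (m + 1),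
          (Nat.choose m ℓ : ℝ) * (1 - p) ^ ℓ / genBinom ((m : ℝ) / x - 1) ℓ := by
    unfold closedE
    refine Finset.sum_congr rfl fun l hl => ?_
    rw [Finset.card_empty]
    exact term_eq m hm p x hx0 l (by have := Finset.mem_range.mp hl; omega)
  rw [← hc, ← h]
  rw [tsum_subtype (langG m) (fun w => wordWeight m p w * x ^ w.length)]
  have hinv : Function.Involutive (List.reverse : List (Fin m ⊕ Fin m) → _) :=
    List.reverse_reverse
  rw [← hinv.toPerm.tsum_eq (fun w => summ m p x ∅ w)]
  refine tsum_congr fun w => ?_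
  have hG : w ∈ langG m ↔ relG m ∅ w := by simp [langG, relG]
  have hprod : (w.reverse.map (letterW m p x)).prod = (w.map (letterW m p x)).prod :=
    ((List.reverse_perm w).map _).prod_eq
  change _ = summ m p x ∅ w.reverse
  by_cases hw : w ∈ langG m
  · rw [Set.indicator_of_mem hw, wordWeight_mul]
    rw [summ_pos _ _ _ _ _ (by rw [List.reverse_reverse]; exact hG.mp hw), hprod]
  · rw [Set.indicator_of_notMem hw]
    rw [summ_neg _ _ _ _ _ (by rw [List.reverse_reverse]; exact fun h => hw (hG.mpr h))]
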